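/- arXiv:1903.08853 — 2 statements merged into one kernel-verified Lean document; each statement's English description precedes it below -/
import Mathlib

section
/- Suppose that for every x ∈ X the set A(x) is compact and that for every x ∈ X and every Borel set Λ ⊆ X the map a ↦ Q(Λ|x,a) is continuous on A(x). Then there exists a sequence (ξ_k)_{k≥1} of measurable selectors of the multifunction x ↦ A(x) such that A(x) equals the closure of {ξ_k(x) : k ≥ 1} for every x ∈ X, and the Markov kernel P on X given X defined by P(dy|x) = Σ_{k≥1} 2^{-k} Q(dy|x,ξ_k(x)) satisfies Q(·|x,a) ≪ P(·|x) for every (x,a) ∈ K. -/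
open MeasureTheory ProbabilityTheory Set
open scoped ENNReal ProbabilityTheory

/-- A sequence of sets is countably separable if its terms are contained in measurable sets with
empty intersection. -/
def CountablySeparable {α : Type*} [MeasurableSpace α] (s : ℕ → Set α) : Prop :=
  ∃ E : ℕ → Set α, (∀ n, s n ⊆ E n) ∧ (∀ n, MeasurableSet (E n)) ∧ ⋂ n, E n = ∅

theorem CountablySeparable.of_subset_iUnion {α : Type*} [MeasurableSpace α] {s : ℕ → Set α}
    (i : ℕ) (t : ℕ → ℕ → Set α) (hi : s i ⊆ ⋃ k, t k i) (hne : ∀ k, ∀ n ≠ i, s n ⊆ t k n)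
    (ht : ∀ k, CountablySeparable (t k)) : CountablySeparable s := by
  choose E hsub hmeas hempty using ht
  refine ⟨fun n => if n = i then ⋃ k, E k n else ⋂ k, E k n, fun n => ?_, fun n => ?_, ?_⟩
  · dsimp only
    split_ifs with h
    · subst h
      exact hi.trans (iUnion_mono fun k => hsub k n)
    · exact subset_iInter fun k => (hne k n h).trans (hsub k n)
  · dsimp only
    split_ifs
    · exact .iUnion fun k => hmeas k n
    · exact .iInter fun k => hmeas k n
  · refine eq_empty_of_forall_notMem fun x hx => ?_
    rw [mem_iInter] at hx
    obtain ⟨k, hk⟩ : ∃ k, x ∈ E k i := by simpa using hx i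
    have hmem : x ∈ ⋂ n, E k n := by
      refine mem_iInter.2 fun n => ?_
      by_cases h : n = i
      · exact h ▸ hk
      · have hn := hx n
        rw [if_neg h] at hn
        exact mem_iInter.1 hn k
    simp [hempty k] at hmem

/-- The **Novikov separation theorem** for continuous images of the Baire space. -/
theorem countablySeparable_range {α : Type*} [TopologicalSpace α] [T2Space α]
    [MeasurableSpace α] [OpensMeasurableSpace α] (f : ℕ → (ℕ → ℕ) → α)
    (hf : ∀ n, Continuous (f n)) (h : ⋂ n, range (f n) = ∅) :
    CountablySeparable fun n => range (f n) := by
  let C : (ℕ → ℕ) → ℕ → ℕ → Set (ℕ → ℕ) := fun x m n =>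
    {y | ∀ j, Nat.pair n j < m → y j = x (Nat.pair n j)}
  have C_congr : ∀ {x x' : ℕ → ℕ} {m : ℕ}, (∀ i < m, x i = x' i) → C x m = C x' m := by
    intro x x' m hx
    funext n
    ext y
    exact forall_congr' fun j => imp_congr_right fun hj => by rw [hx _ hj]
  by_contra hsep
  have step : ∀ (m : ℕ) (x : ℕ → ℕ), ∃ k : ℕ,
      ¬ CountablySeparable (fun n => f n '' C x m n) →
      ¬ CountablySeparable (fun n => f n '' C (Function.update x m k) (m + 1) n) := by
    intro m x
    by_contra! hcon
    refine (hcon 0).1 (.of_subset_iUnion m.unpair.1 _ ?_ ?_ fun k => (hcon k).2)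
    · rintro _ ⟨y, hy, rfl⟩
      refine mem_iUnion.2 ⟨y m.unpair.2, y, fun j hj => ?_, rfl⟩
      rcases Nat.lt_succ_iff_lt_or_eq.1 hj with hlt | heq
      · rw [Function.update_of_ne hlt.ne]
        exact hy j hlt
      · have hj2 : m.unpair.2 = j := by rw [← heq, Nat.unpair_pair]
        rw [heq, Function.update_self, hj2]
    · rintro k n hn _ ⟨y, hy, rfl⟩
      refine ⟨y, fun j hj => ?_, rfl⟩
      have hne : Nat.pair n j ≠ m := by
        rintro rfl
        simp at hn
      rw [Function.update_of_ne hne]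
      exact hy j (by omega)
  choose F hF using step
  let R : ℕ → ℕ → ℕ := fun m => Nat.rec 0 (fun m r => Function.update r m (F m r)) m
  have R_succ : ∀ m, R (m + 1) = Function.update (R m) m (F m (R m)) := fun _ => rfl
  have R_insep : ∀ m, ¬ CountablySeparable (fun n => f n '' C (R m) m n) := by
    intro m
    induction m with
    | zero => simpa [C] using hsep
    | succ m ih => exact hF m _ ih
  let x : ℕ → ℕ := fun m => R (m + 1) m
  have R_eq : ∀ m, ∀ i < m, R m i = x i := by
    intro m
    induction m with
    | zero => simp
    | succ m ih =>
      intro i hi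
      rcases Nat.lt_succ_iff_lt_or_eq.1 hi with hlt | rfl
      · rw [R_succ, Function.update_of_ne hlt.ne, ih i hlt]
      · rfl
  have insep : ∀ m, ¬ CountablySeparable (fun n => f n '' C x m n) := fun m => by
    rw [← C_congr (R_eq m)]
    exact R_insep m
  let y : ℕ → ℕ → ℕ := fun n j => x (Nat.pair n j)
  have small : ∀ (n : ℕ) (U : Set α), IsOpen U → f n (y n) ∈ U →
      ∃ M, ∀ m ≥ M, f n '' C x m n ⊆ U := by
    intro n U hU hy
    obtain ⟨_, ⟨z, L, rfl⟩, hz, hzU⟩ :=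
      (PiNat.isTopologicalBasis_cylinders (fun _ : ℕ => ℕ)).mem_nhds_iff.1
        ((hU.preimage (hf n)).mem_nhds hy)
    refine ⟨Nat.pair n L, fun m hm => ?_⟩
    rintro _ ⟨w, hw, rfl⟩
    refine hzU fun j hj => ?_
    rw [hw j ((Nat.pair_lt_pair_right n hj).trans_le hm)]
    exact hz j hj
  by_cases hall : ∀ n, f n (y n) = f 0 (y 0)
  · have hmem : f 0 (y 0) ∈ ⋂ n, range (f n) := mem_iInter.2 fun n => ⟨y n, hall n⟩
    simp [h] at hmem
  · push Not at hall
    obtain ⟨n, hn⟩ := hall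
    obtain ⟨U, V, hU, hV, hnU, h0V, hUV⟩ := t2_separation hn
    obtain ⟨M, hM⟩ := small n U hU hnU
    obtain ⟨N, hN⟩ := small 0 V hV h0V
    have hn0 : n ≠ 0 := by
      rintro rfl
      exact hn rfl
    refine insep (max M N) ⟨fun k => if k = n then U else if k = 0 then V else univ,
      fun k => ?_, fun k => ?_, ?_⟩
    · dsimp only
      split_ifs with h1 h2
      · exact h1 ▸ hM _ (le_max_left _ _)
      · exact h2 ▸ hN _ (le_max_right _ _)
      · exact subset_univ _
    · dsimp only
      split_ifs
      exacts [hU.measurableSet, hV.measurableSet, .univ]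
    · refine eq_empty_of_forall_notMem fun z hz => ?_
      rw [mem_iInter] at hz
      have hzU := hz n
      have hzV := hz 0
      simp only [if_true, hn0.symm, if_false] at hzU hzV
      exact disjoint_left.1 hUV hzU hzV

/-- The **Novikov separation theorem**: a sequence of analytic sets with empty intersection is
contained termwise in a sequence of Borel sets with empty intersection. -/
theorem countablySeparable_of_analyticSet {α : Type*} [TopologicalSpace α] [T2Space α]
    [MeasurableSpace α] [OpensMeasurableSpace α] {s : ℕ → Set α}
    (hs : ∀ n, AnalyticSet (s n)) (h : ⋂ n, s n = ∅) : CountablySeparable s := by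
  by_cases hemp : ∃ n, s n = ∅
  · obtain ⟨n, hn⟩ := hemp
    refine ⟨fun k => if k = n then ∅ else univ, fun k => ?_, fun k => ?_, ?_⟩
    · dsimp only
      split_ifs with hk
      · rw [hk, hn]
      · exact subset_univ _
    · dsimp only
      split_ifs
      exacts [.empty, .univ]
    · refine eq_empty_of_forall_notMem fun z hz => ?_
      simpa using mem_iInter.1 hz n
  · push Not at hemp
    simp only [AnalyticSet] at hs
    choose f hf hfs using fun n => (hs n).resolve_left (hemp n).ne_empty
    obtain rfl : (fun n => range (f n)) = s := funext hfs
    exact countablySeparable_range f hf h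

/-- The projection of a Borel set with compact sections in a compact metrizable space is Borel. -/
theorem measurableSet_fst_image_of_compactSpace {X Y : Type*} [TopologicalSpace X]
    [PolishSpace X] [MeasurableSpace X] [BorelSpace X] [TopologicalSpace Y] [PolishSpace Y]
    [CompactSpace Y] [Nonempty Y] [MeasurableSpace Y] [BorelSpace Y] {K : Set (X × Y)}
    (hK : MeasurableSet K) (hc : ∀ x, IsClosed {y | (x, y) ∈ K}) :
    MeasurableSet (Prod.fst '' K) := by
  obtain ⟨V, hV⟩ := (TopologicalSpace.countable_countableBasis Y).exists_eq_range
    (by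
      obtain ⟨y⟩ := ‹Nonempty Y›
      obtain ⟨v, hv, -⟩ := (TopologicalSpace.isBasis_countableBasis Y).exists_subset_of_mem_open
        (mem_univ y) isOpen_univ
      exact ⟨v, hv⟩)
  have hbasis : TopologicalSpace.IsTopologicalBasis (range V) :=
    hV ▸ TopologicalSpace.isBasis_countableBasis Y
  have hVo : ∀ n, IsOpen (V n) := fun n => hbasis.isOpen (mem_range_self n)
  let S : ℕ → Set X := fun n => Prod.fst '' (K ∩ Prod.snd ⁻¹' V n)
  have hS : ∀ n, AnalyticSet (S n) := fun n =>
    (hK.inter (measurable_snd (hVo n).measurableSet)).analyticSet.image_of_continuous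
      continuous_fst
  have hD : ∀ n, AnalyticSet ((Kᶜ ∩ Prod.snd ⁻¹' (V n)ᶜ) ∪ (Kᶜ ∩ Prod.fst ⁻¹' S n)) := by
    intro n
    rw [union_eq_iUnion, inter_eq_iInter (s₁ := Kᶜ) (s₂ := Prod.fst ⁻¹' S n)]
    refine .iUnion fun b => ?_
    cases b
    · refine .iInter fun b => ?_
      cases b
      · exact (hS n).preimage continuous_fst
      · exact hK.compl.analyticSet
    · exact (hK.compl.inter (measurable_snd (hVo n).measurableSet.compl)).analyticSet
  obtain ⟨E, hDE, hE, hEe⟩ := countablySeparable_of_analyticSet hD (by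
    refine eq_empty_of_forall_notMem fun p hp => ?_
    rw [mem_iInter] at hp
    have hpK : p ∉ K := by
      rcases hp 0 with h | h <;> exact h.1
    obtain ⟨_, ⟨n, rfl⟩, hpn, hn⟩ := hbasis.mem_nhds_iff.1
      ((hc p.1).isOpen_compl.mem_nhds (show p.2 ∈ {y | (p.1, y) ∈ K}ᶜ from hpK))
    rcases hp n with h | ⟨-, q, ⟨hqK, hqV⟩, hq⟩
    · exact h.2 hpn
    · refine hn hqV ?_
      change (p.1, q.2) ∈ K
      rw [← hq]
      exact hqK)
  have hB : ∀ n, MeasurablySeparable (Prod.fst '' (Kᶜ \ E n)) (S n) := fun n => by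
    refine AnalyticSet.measurablySeparable
      ((hK.compl.diff (hE n)).analyticSet.image_of_continuous continuous_fst) (hS n) ?_
    rw [disjoint_left]
    rintro _ ⟨p, ⟨hpK, hpE⟩, rfl⟩ hpS
    exact hpE (hDE n (.inr ⟨hpK, hpS⟩))
  choose B hAB hBS hBm using hB
  have hcompl : (Prod.fst '' K)ᶜ =
      ⋃ F ∈ {F : Finset ℕ | ⋃ n ∈ F, V n = univ}, ⋂ n ∈ F, B n := by
    ext x
    simp only [mem_iUnion, mem_iInter, mem_ofPred_eq, exists_prop]
    constructor
    · intro hx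
      obtain ⟨F, hF⟩ := isCompact_univ.elim_finite_subcover
        (fun n : {n // x ∈ B n} => V n) (fun n => hVo n) (fun y _ => by
          have hxy : (x, y) ∈ Kᶜ := fun h => hx ⟨_, h, rfl⟩
          obtain ⟨n, hn⟩ : ∃ n, (x, y) ∉ E n := by
            by_contra! hcon
            have := mem_iInter.2 hcon
            simp [hEe] at this
          refine mem_iUnion.2 ⟨⟨n, hAB n ⟨_, ⟨hxy, hn⟩, rfl⟩⟩, ?_⟩
          by_contra hyV
          exact hn (hDE n (.inl ⟨hxy, hyV⟩)))
      refine ⟨F.map ⟨Subtype.val, Subtype.val_injective⟩, ?_, ?_⟩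
      · refine univ_subset_iff.1 (hF.trans ?_)
        exact iUnion₂_subset fun n hn =>
          subset_biUnion_of_mem (u := V) (Finset.mem_map_of_mem _ hn)
      · intro n hn
        obtain ⟨k, -, rfl⟩ := Finset.mem_map.1 hn
        exact k.2
    · rintro ⟨F, hF, hFx⟩ ⟨p, hp, rfl⟩
      obtain ⟨n, hn, hpV⟩ : ∃ n ∈ F, p.2 ∈ V n := by
        simpa using hF.ge (mem_univ p.2)
      exact disjoint_left.1 (hBS n) ⟨p, ⟨hp, hpV⟩, rfl⟩ (hFx n hn)
  rw [← MeasurableSet.compl_iff, hcompl]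
  exact .biUnion (to_countable _) fun F _ => .biInter (to_countable _) fun n _ => hBm n

/-- **Novikov's theorem**: the projection of a Borel set with compact sections is Borel. -/
theorem measurableSet_fst_image_of_isCompact {X A : Type*} [MeasurableSpace X]
    [StandardBorelSpace X] [TopologicalSpace A] [PolishSpace A] [MeasurableSpace A]
    [BorelSpace A] {K : Set (X × A)} (hK : MeasurableSet K)
    (hc : ∀ x, IsCompact {a | (x, a) ∈ K}) : MeasurableSet (Prod.fst '' K) := by
  let := upgradeStandardBorel X
  let := TopologicalSpace.upgradeIsCompletelyMetrizable A
  obtain ⟨g, hg⟩ := Metric.PiNatEmbed.exists_embedding_to_hilbert_cube (X := A)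
  have hgm : MeasurableEmbedding (Prod.map id g : X × A → X × (ℕ → unitInterval)) :=
    MeasurableEmbedding.id.prodMap (hg.continuous.measurableEmbedding hg.injective)
  have := measurableSet_fst_image_of_compactSpace (hgm.measurableSet_image.2 hK) (fun x => by
    convert ((hc x).image hg.continuous).isClosed using 1
    ext y
    simp)
  rwa [image_image] at this

/-- Minimizing a continuous function over measurable compact sections is measurable. -/
theorem exists_measurable_minimum {X A : Type*} [MeasurableSpace X]
    [StandardBorelSpace X] [TopologicalSpace A] [PolishSpace A] [MeasurableSpace A]
    [BorelSpace A] {K : Set (X × A)} (hK : MeasurableSet K)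
    (hc : ∀ x, IsCompact {a | (x, a) ∈ K}) (hne : ∀ x, ∃ a, (x, a) ∈ K)
    {h : A → unitInterval} (hh : Continuous h) :
    ∃ m : X → unitInterval, Measurable m ∧ ∀ x, ∃ a, (x, a) ∈ K ∧ h a = m x := by
  choose b hb hmin using fun x => (hc x).exists_isMinOn (hne x) hh.continuousOn
  refine ⟨fun x => h (b x), measurable_of_Iic fun r => ?_, fun x => ⟨b x, hb x, rfl⟩⟩
  convert measurableSet_fst_image_of_isCompact
    (hK.inter ((hh.measurable.comp measurable_snd) (measurableSet_Iic (a := r))))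
    (fun x => (hc x).inter_right (isClosed_Iic.preimage hh)) using 1
  ext x
  constructor
  · exact fun hx => ⟨(x, b x), ⟨hb x, hx⟩, rfl⟩
  · rintro ⟨⟨x, a⟩, ⟨ha, har⟩, rfl⟩
    change h a ≤ r at har
    exact le_trans (hmin x ha) har

/-- A Borel set with nonempty compact sections admits a measurable selector. -/
theorem exists_measurable_selector_of_isCompact {X A : Type*} [MeasurableSpace X]
    [StandardBorelSpace X] [TopologicalSpace A] [PolishSpace A] [MeasurableSpace A]
    [BorelSpace A] {K : Set (X × A)} (hK : MeasurableSet K)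
    (hc : ∀ x, IsCompact {a | (x, a) ∈ K}) (hne : ∀ x, ∃ a, (x, a) ∈ K) :
    ∃ ξ : X → A, Measurable ξ ∧ ∀ x, (x, ξ x) ∈ K := by
  let := TopologicalSpace.upgradeIsCompletelyMetrizable A
  obtain ⟨g, hg⟩ := Metric.PiNatEmbed.exists_embedding_to_hilbert_cube (X := A)
  have hgn : ∀ n, Continuous fun a => g a n := fun n => (continuous_apply n).comp hg.continuous
  let T := {L : Set (X × A) //
    MeasurableSet L ∧ (∀ x, IsCompact {a | (x, a) ∈ L}) ∧ ∀ x, ∃ a, (x, a) ∈ L}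
  have step : ∀ (n : ℕ) (L : T), ∃ (L' : T) (m : X → unitInterval), Measurable m ∧
      L'.1 ⊆ L.1 ∧ ∀ p ∈ L'.1, g p.2 n = m p.1 := by
    rintro n ⟨L, hL, hLc, hLne⟩
    obtain ⟨m, hm, hmL⟩ := exists_measurable_minimum hL hLc hLne (hgn n)
    refine ⟨⟨L ∩ {p | g p.2 n = m p.1}, hL.inter (measurableSet_eq_fun
      ((hgn n).measurable.comp measurable_snd) (hm.comp measurable_fst)), fun x =>
        (hLc x).inter_right (isClosed_eq (hgn n) (continuous_const (y := m x))), hmL⟩, m, hm,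
        inter_subset_left, fun p hp => hp.2⟩
  choose next m hm hsub heq using step
  let L : ℕ → T := fun n => Nat.rec ⟨K, hK, hc, hne⟩ next n
  have hL : ∀ x, (⋂ n, {a | (x, a) ∈ (L n).1}).Nonempty := fun x =>
    IsCompact.nonempty_iInter_of_sequence_nonempty_isCompact_isClosed _
      (fun n a ha => hsub n (L n) ha) (fun n => (L n).2.2.2 x) ((L 0).2.2.1 x)
      fun n => ((L n).2.2.1 x).isClosed
  choose ξ hξ using hL
  simp only [mem_iInter, mem_ofPred_eq] at hξ
  refine ⟨ξ, ?_, fun x => hξ x 0⟩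
  rw [← (hg.continuous.measurableEmbedding hg.injective).measurable_comp_iff, measurable_pi_iff]
  intro n
  convert hm n (L n) using 1
  funext x
  exact heq n (L n) _ (hξ x (n + 1))

/-- A Borel set with nonempty compact sections admits a **Castaing representation**. -/
theorem exists_castaing_representation {X A : Type*} [MeasurableSpace X]
    [StandardBorelSpace X] [TopologicalSpace A] [PolishSpace A] [MeasurableSpace A]
    [BorelSpace A] {K : Set (X × A)} (hK : MeasurableSet K)
    (hc : ∀ x, IsCompact {a | (x, a) ∈ K}) (hne : ∀ x, ∃ a, (x, a) ∈ K) :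
    ∃ ξ : ℕ → X → A, (∀ k, Measurable (ξ k)) ∧ (∀ k x, (x, ξ k x) ∈ K) ∧
      ∀ x, {a | (x, a) ∈ K} = closure (range fun k => ξ k x) := by
  rcases isEmpty_or_nonempty X with hX | ⟨⟨x₀⟩⟩
  · exact ⟨fun _ => isEmptyElim, fun _ => measurable_of_empty _, fun _ => isEmptyElim,
      isEmptyElim⟩
  obtain ⟨a₀, -⟩ := hne x₀
  have : Nonempty A := ⟨a₀⟩
  let := TopologicalSpace.upgradeIsCompletelyMetrizable A
  obtain ⟨ϑ, hϑm, hϑ⟩ := exists_measurable_selector_of_isCompact hK hc hne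
  have key : ∀ C : Set A, IsClosed C → ∃ ξ : X → A, Measurable ξ ∧ (∀ x, (x, ξ x) ∈ K) ∧
      ∀ x a, (x, a) ∈ K → a ∈ C → ξ x ∈ C := by
    intro C hC
    have hKC : MeasurableSet (K ∩ Prod.snd ⁻¹' C) := hK.inter (measurable_snd hC.measurableSet)
    have hKCc : ∀ x, IsCompact {a | (x, a) ∈ K ∩ Prod.snd ⁻¹' C} := fun x =>
      (hc x).inter_right hC
    have hS := measurableSet_fst_image_of_isCompact hKC hKCc
    set S := Prod.fst '' (K ∩ Prod.snd ⁻¹' C)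
    have hSx : ∀ x a, (x, a) ∈ K → a ∈ C → x ∈ S := fun x a ha haC => ⟨_, ⟨ha, haC⟩, rfl⟩
    have hG : MeasurableSet {p : X × A | p.1 ∉ S ∧ p.2 = ϑ p.1} :=
      (measurable_fst hS.compl).inter
        (measurableSet_eq_fun measurable_snd (hϑm.comp measurable_fst))
    obtain ⟨ξ, hξm, hξ⟩ := exists_measurable_selector_of_isCompact (hKC.union hG) (fun x => by
      by_cases hx : x ∈ S
      · convert hKCc x using 1
        ext a
        simp [hx]
      · convert isCompact_singleton (x := ϑ x) using 1
        ext a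
        simp only [mem_ofPred_eq, mem_union, hx, not_false_eq_true, true_and, mem_singleton_iff]
        exact or_iff_right fun h => hx ⟨_, h, rfl⟩) (fun x => by
      by_cases hx : x ∈ S
      · obtain ⟨⟨x, a⟩, ha, rfl⟩ := hx
        exact ⟨a, .inl ha⟩
      · exact ⟨ϑ x, .inr ⟨hx, rfl⟩⟩)
    refine ⟨ξ, hξm, fun x => ?_, fun x a ha haC => ?_⟩
    · rcases hξ x with h | ⟨-, h⟩
      · exact h.1
      · change ξ x = ϑ x at h
        exact h ▸ hϑ x
    · rcases hξ x with h | h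
      · exact h.2
      · exact absurd (hSx x a ha haC) h.1
  choose ξ hξm hξ hξC using fun p : ℕ × ℕ =>
    key (Metric.closedBall (TopologicalSpace.denseSeq A p.1) (1 / (p.2 + 1 : ℝ)))
      Metric.isClosed_closedBall
  refine ⟨fun k => ξ k.unpair, fun k => hξm _, fun k => hξ _, fun x => Subset.antisymm ?_ ?_⟩
  · intro a ha
    rw [Metric.mem_closure_iff]
    intro ε hε
    obtain ⟨k, hk⟩ := exists_nat_one_div_lt (half_pos hε)
    obtain ⟨n, hn⟩ := (TopologicalSpace.denseRange_denseSeq A).exists_dist_lt a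
      (Nat.one_div_pos_of_nat (α := ℝ) (n := k))
    refine ⟨_, ⟨Nat.pair n k, rfl⟩, ?_⟩
    have hmem := hξC (n, k) x a ha (Metric.mem_closedBall.2 hn.le)
    rw [Metric.mem_closedBall'] at hmem
    dsimp only at hmem ⊢
    rw [Nat.unpair_pair]
    linarith [dist_triangle a (TopologicalSpace.denseSeq A n) (ξ (n, k) x)]
  · refine closure_minimal ?_ (hc x).isClosed
    rintro _ ⟨k, rfl⟩
    exact hξ _ x

/-- Under conditions (S1) (compact action sets) and (S2) (strong continuity
of the transition kernel in the action variable), there exists a sequence `(ξ_k)` of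
measurable selectors of the multifunction `x ↦ A(x)` whose values are dense in `A(x)`, and
the Markov kernel `P(dy|x) = Σ_{k≥1} 2^{-k} Q(dy|x,ξ_k(x))` satisfies
`Q(·|x,a) ≪ P(·|x)` for every `(x,a) ∈ K`. -/
theorem statement_0
    {X A : Type*} [MeasurableSpace X] [StandardBorelSpace X]
    [TopologicalSpace A] [MeasurableSpace A] [BorelSpace A] [PolishSpace A]
    (K : Set (X × A)) (hK : MeasurableSet K) (hne : ∀ x : X, ∃ a : A, (x, a) ∈ K)
    (ϑ : X → A) (hϑm : Measurable ϑ) (hϑ : ∀ x, (x, ϑ x) ∈ K)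
    (Q : Kernel (X × A) X) [IsMarkovKernel Q]
    (ν : Measure X) [IsProbabilityMeasure ν]
    (hS1 : ∀ x : X, IsCompact {a | (x, a) ∈ K})
    (hS2 : ∀ (x : X) (Λ : Set X), MeasurableSet Λ →
      ContinuousOn (fun a => Q (x, a) Λ) {a | (x, a) ∈ K}) :
    ∃ ξ : ℕ → X → A,
      (∀ k, Measurable (ξ k)) ∧ (∀ k x, (x, ξ k x) ∈ K) ∧
      (∀ x, {a | (x, a) ∈ K} = closure (Set.range fun k => ξ k x)) ∧
      ∃ P : Kernel X X, IsMarkovKernel P ∧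
        (∀ x, P x = Measure.sum fun k => (2 ^ (k + 1) : ℝ≥0∞)⁻¹ • Q (x, ξ k x)) ∧
        ∀ q ∈ K, Q q ≪ P q.1 := by
  obtain ⟨ξ, hξm, hξ, hξd⟩ := exists_castaing_representation hK hS1 hne
  refine ⟨ξ, hξm, hξ, hξd, ⟨fun x => Measure.sum fun k => (2 ^ (k + 1) : ℝ≥0∞)⁻¹ • Q (x, ξ k x),
    ?_⟩, ⟨fun x => ⟨?_⟩⟩, fun x => rfl, ?_⟩
  · refine Measure.measurable_of_measurable_coe _ fun s hs => ?_
    simp only [Measure.sum_apply _ hs, Measure.smul_apply, smul_eq_mul]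
    exact .tsum fun k =>
      ((Q.measurable_coe hs).comp (measurable_id.prodMk (hξm k))).const_mul _
  · change Measure.sum (fun k => (2 ^ (k + 1) : ℝ≥0∞)⁻¹ • Q (x, ξ k x)) univ = 1
    simp only [Measure.sum_apply _ .univ, Measure.smul_apply, smul_eq_mul, measure_univ, mul_one,
      ENNReal.inv_pow, ENNReal.tsum_geometric_add_one, ENNReal.one_sub_inv_two, inv_inv]
    exact ENNReal.inv_mul_cancel (by simp) (by simp)
  · rintro ⟨x, a⟩ ha
    refine Measure.AbsolutelyContinuous.mk fun s hs h0 => ?_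
    change Measure.sum (fun k => (2 ^ (k + 1) : ℝ≥0∞)⁻¹ • Q (x, ξ k x)) s = 0 at h0
    rw [Measure.sum_apply_eq_zero] at h0
    have hzero : MapsTo (fun a => Q (x, a) s) (range fun k => ξ k x) {0} := by
      rintro _ ⟨k, rfl⟩
      have hk := h0 k
      rw [Measure.smul_apply, smul_eq_mul, mul_eq_zero, ENNReal.inv_eq_zero] at hk
      exact hk.resolve_left (by finiteness)
    have hsub : (range fun k => ξ k x) ⊆ {a | (x, a) ∈ K} := by
      rintro _ ⟨k, rfl⟩
      exact hξ k x
    have hcl := ((hS2 x s hs a ha).mono hsub).mem_closure ((hξd x).subset ha) hzero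
    rwa [closure_singleton] at hcl
end

section
/- Let R be a nonempty set of measures on a measurable space K that is closed under convex combinations, and let h, g_1,…,g_m : K → ℝ be measurable functions such that μ(h^+), μ(h^-), μ(g_i^+), μ(g_i^-) are finite for every μ ∈ R and every i, and such that V(θ) = sup{μ(h) : μ ∈ R and μ(g_i) ≥ θ_i for all i} is real-valued on C = ∪_{μ∈R} {θ ∈ ℝ^m : μ(g_i) ≥ θ_i for all i}. If θ̃ lies in the interior of C (equivalently, there exists μ̃ ∈ R with μ̃(g_i) > θ̃_i for all i), then the Lagrangian duality identity holds: inf{ sup{μ(h − Σ_{i=1}^m λ_i g_i) : μ ∈ R} + ⟨λ, θ̃⟩ : λ ∈ ℝ^m, λ ≤ 0 } = sup{μ(h) : μ ∈ R and μ(g_i) ≥ θ̃_i for all i}. -/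
open MeasureTheory Set
open scoped ENNReal

noncomputable section

/-- `μ(f) = μ(f⁺) − μ(f⁻)` as a real number (meaningful when both parts are finite). -/
def mVal {K : Type*} [MeasurableSpace K] (μ : Measure K) (f : K → ℝ) : ℝ :=
  (∫⁻ x, ENNReal.ofReal (f x) ∂μ).toReal - (∫⁻ x, ENNReal.ofReal (-f x) ∂μ).toReal

theorem integrable_of_lintegral_ofReal_lt_top {K : Type*} [MeasurableSpace K] {μ : Measure K}
    {f : K → ℝ} (hf : Measurable f) (hpos : (∫⁻ x, ENNReal.ofReal (f x) ∂μ) < ⊤)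
    (hneg : (∫⁻ x, ENNReal.ofReal (-f x) ∂μ) < ⊤) : Integrable f μ := by
  refine ⟨hf.aestronglyMeasurable, ?_⟩
  rw [hasFiniteIntegral_iff_norm]
  calc (∫⁻ x, ENNReal.ofReal ‖f x‖ ∂μ)
      ≤ ∫⁻ x, (ENNReal.ofReal (f x) + ENNReal.ofReal (-f x)) ∂μ := by
        refine lintegral_mono fun x => ?_
        rcases le_total 0 (f x) with hx | hx
        · simp [Real.norm_of_nonneg hx]
        · simp [Real.norm_of_nonpos hx]
    _ = _ := lintegral_add_left hf.ennreal_ofReal _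
    _ < ⊤ := ENNReal.add_lt_top.2 ⟨hpos, hneg⟩

theorem mVal_eq_integral {K : Type*} [MeasurableSpace K] {μ : Measure K} {f : K → ℝ}
    (hf : Integrable f μ) : mVal μ f = ∫ x, f x ∂μ :=
  (integral_eq_lintegral_pos_part_sub_lintegral_neg_part hf).symm

theorem mVal_convex_combination {K : Type*} [MeasurableSpace K] {μ ν : Measure K} {f : K → ℝ}
    (hμ : Integrable f μ) (hν : Integrable f ν) {a b : ℝ} (ha : 0 ≤ a) (hb : 0 ≤ b) :
    mVal (ENNReal.ofReal a • μ + ENNReal.ofReal b • ν) f = a * mVal μ f + b * mVal ν f := by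
  have hμ' := hμ.smul_measure (c := ENNReal.ofReal a) ENNReal.ofReal_ne_top
  have hν' := hν.smul_measure (c := ENNReal.ofReal b) ENNReal.ofReal_ne_top
  rw [mVal_eq_integral (hμ'.add_measure hν'), integral_add_measure hμ' hν',
    integral_smul_measure, integral_smul_measure, mVal_eq_integral hμ, mVal_eq_integral hν,
    ENNReal.toReal_ofReal ha, ENNReal.toReal_ofReal hb, smul_eq_mul, smul_eq_mul]

theorem mVal_sub_sum {K ι : Type*} [MeasurableSpace K] [Fintype ι] {μ : Measure K} {h : K → ℝ}
    {g : ι → K → ℝ} (hh : Integrable h μ) (hg : ∀ i, Integrable (g i) μ) (c : ι → ℝ) :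
    mVal μ (fun x => h x - ∑ i, c i * g i x) = mVal μ h - ∑ i, c i * mVal μ (g i) := by
  have hcg : ∀ i, Integrable (fun x => c i * g i x) μ := fun i => (hg i).const_mul (c i)
  have hsum : Integrable (fun x => ∑ i, c i * g i x) μ := integrable_finsetSum _ fun i _ => hcg i
  have hdiff : Integrable (fun x => h x - ∑ i, c i * g i x) μ := hh.sub hsum
  rw [mVal_eq_integral hdiff, integral_sub hh hsum,
    integral_finsetSum _ fun i _ => hcg i, mVal_eq_integral hh]
  simp only [integral_const_mul, mVal_eq_integral (hg _)]

/-- The strict hypograph of a subset of `ℝ × ℝ^ι` for the componentwise strict order. -/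
def strictLower {ι : Type*} (A : Set (ℝ × (ι → ℝ))) : Set (ℝ × (ι → ℝ)) :=
  {d | ∃ p ∈ A, d.1 < p.1 ∧ ∀ i, d.2 i < p.2 i}

theorem isOpen_strictLower {ι : Type*} [Finite ι] (A : Set (ℝ × (ι → ℝ))) :
    IsOpen (strictLower A) := by
  have heq : strictLower A = ⋃ p ∈ A, ({d | d.1 < p.1} ∩ ⋂ i, {d | d.2 i < p.2 i}) := by
    ext d
    simp only [strictLower, mem_ofPred_eq, mem_iUnion, mem_inter_iff, mem_iInter, exists_prop]
  rw [heq]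
  refine isOpen_biUnion fun p _ => (isOpen_lt (by fun_prop) (by fun_prop)).inter ?_
  exact isOpen_iInter_of_finite fun i => isOpen_lt (by fun_prop) (by fun_prop)

theorem convex_strictLower {ι : Type*} {A : Set (ℝ × (ι → ℝ))} (hA : Convex ℝ A) :
    Convex ℝ (strictLower A) := by
  have combo_lt : ∀ {a b x y x' y' : ℝ}, 0 ≤ a → 0 ≤ b → a + b = 1 → x < x' → y < y' →
      a * x + b * y < a * x' + b * y' := by
    intro a b x y x' y' ha hb hab hx hy
    rcases ha.eq_or_lt with rfl | ha
    · have hb1 : b = 1 := by linarith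
      simpa [hb1] using hy
    · nlinarith [mul_lt_mul_of_pos_left hx ha, mul_le_mul_of_nonneg_left hy.le hb]
  rintro d ⟨p, hp, hd1, hd2⟩ e ⟨q, hq, he1, he2⟩ a b ha hb hab
  exact ⟨a • p + b • q, hA hp hq ha hb hab, combo_lt ha hb hab hd1 he1,
    fun i => combo_lt ha hb hab (hd2 i) (he2 i)⟩

/-- A linear functional bounded above on a ray cannot increase along it. -/
theorem nonpos_of_forall_add_mul_lt {x y c : ℝ} (hlt : ∀ r : ℝ, 0 ≤ r → x + r * y < c) :
    y ≤ 0 := by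
  by_contra! hy
  have hx := hlt 0 le_rfl
  have hr := hlt ((c - x) / y) (div_nonneg (by linarith) hy.le)
  rw [div_mul_cancel₀ _ hy.ne'] at hr
  linarith

/-- Existence of Lagrange multipliers for a convex set of attainable values under Slater's
condition. -/
theorem exists_lagrange_multiplier {ι : Type*} [Fintype ι] {A : Set (ℝ × (ι → ℝ))}
    (hA : Convex ℝ A) {θ : ι → ℝ} {v : ℝ} (hSlater : ∃ p ∈ A, ∀ i, θ i < p.2 i)
    (hv : ∀ p ∈ A, (∀ i, θ i ≤ p.2 i) → p.1 ≤ v) :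
    ∃ lam : ι → ℝ, (∀ i, lam i ≤ 0) ∧
      ∀ p ∈ A, p.1 - ∑ i, lam i * p.2 i + ∑ i, lam i * θ i ≤ v := by
  classical
  have hnot : ((v, θ) : ℝ × (ι → ℝ)) ∉ strictLower A := by
    rintro ⟨p, hp, h1, h2⟩
    exact absurd (hv p hp fun i => (h2 i).le) (not_le.2 h1)
  obtain ⟨f, hf⟩ := geometric_hahn_banach_open_point (convex_strictLower hA)
    (isOpen_strictLower A) hnot
  set c : ℝ := f (1, 0) with hc
  set q : ι → ℝ := fun i => f (0, Pi.single i 1) with hq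
  have hrep : ∀ (s : ℝ) (t : ι → ℝ), f (s, t) = s * c + ∑ i, t i * q i := by
    intro s t
    have hst : ((s, t) : ℝ × (ι → ℝ)) =
        s • ((1 : ℝ), (0 : ι → ℝ)) + ∑ i, t i • ((0 : ℝ), (Pi.single i 1 : ι → ℝ)) := by
      ext j
      · simp [Prod.fst_sum]
      · simp [Prod.snd_sum, Finset.sum_apply, Pi.single_apply]
    rw [hst, map_add, map_smul, map_sum]
    simp only [map_smul, smul_eq_mul, hc, hq]
  have hlt : ∀ p ∈ A, ∀ (s : ℝ) (t : ι → ℝ), s < p.1 → (∀ i, t i < p.2 i) →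
      s * c + ∑ i, t i * q i < v * c + ∑ i, θ i * q i := by
    intro p hp s t hs ht
    rw [← hrep, ← hrep]
    exact hf _ ⟨p, hp, hs, ht⟩
  obtain ⟨p₀, hp₀, hθ⟩ := hSlater
  have hc0 : 0 ≤ c := by
    have := nonpos_of_forall_add_mul_lt (x := (p₀.1 - 1) * c + ∑ i, θ i * q i) (y := -c)
      (c := v * c + ∑ i, θ i * q i) fun r hr => by
        have := hlt p₀ hp₀ (p₀.1 - 1 - r) θ (by linarith) hθ
        linarith
    linarith
  have hq0 : ∀ i, 0 ≤ q i := by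
    intro i
    have := nonpos_of_forall_add_mul_lt (x := (p₀.1 - 1) * c + ∑ j, θ j * q j) (y := -q i)
      (c := v * c + ∑ i, θ i * q i) fun r hr => by
        have := hlt p₀ hp₀ (p₀.1 - 1) (fun j => θ j - r * (Pi.single i 1 : ι → ℝ) j)
          (by linarith) fun j => by
            have : 0 ≤ r * (Pi.single i 1 : ι → ℝ) j :=
              mul_nonneg hr (by by_cases hj : j = i <;> simp [hj])
            linarith [hθ j]
        simp only [sub_mul, Finset.sum_sub_distrib, Pi.single_apply, mul_ite, mul_one, mul_zero,
          ite_mul, zero_mul, Finset.sum_ite_eq', Finset.mem_univ, if_true] at this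
        linarith
    linarith
  have hle : ∀ p ∈ A, p.1 * c + ∑ i, p.2 i * q i ≤ v * c + ∑ i, θ i * q i := by
    intro p hp
    refine le_of_forall_pos_lt_add fun ε hε => ?_
    have hS : 0 < c + ∑ i, q i + 1 := by
      have := Finset.sum_nonneg fun i (_ : i ∈ Finset.univ) => hq0 i
      linarith
    set δ := ε / (c + ∑ i, q i + 1)
    have hδ0 : 0 < δ := div_pos hε hS
    have hδε : δ * (c + ∑ i, q i + 1) = ε := div_mul_cancel₀ _ hS.ne'
    have := hlt p hp (p.1 - δ) (fun i => p.2 i - δ) (by linarith) fun i => by linarith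
    simp only [sub_mul, Finset.sum_sub_distrib, ← Finset.mul_sum] at this
    linarith
  have hcpos : 0 < c := by
    refine hc0.lt_of_ne fun hc' => ?_
    have h1 := hlt p₀ hp₀ (p₀.1 - 1) θ (by linarith) hθ
    simp [← hc'] at h1
  refine ⟨fun i => -(q i / c), fun i => neg_nonpos.2 (div_nonneg (hq0 i) hcpos.le), ?_⟩
  intro p hp
  have hsum : ∀ t : ι → ℝ, ∑ i, -(q i / c) * t i = -((∑ i, t i * q i) / c) := by
    intro t
    rw [Finset.sum_div, ← Finset.sum_neg_distrib]
    exact Finset.sum_congr rfl fun i _ => by ring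
  rw [hsum, hsum]
  have key := div_le_div_of_nonneg_right (hle p hp) hcpos.le
  rw [add_div, add_div, mul_div_cancel_right₀ _ hcpos.ne', mul_div_cancel_right₀ _ hcpos.ne'] at key
  linarith

/-- Lagrangian duality. Let `R` be a nonempty set of measures closed
under convex combinations, and `h, g_1, …, g_m` measurable with finite positive and
negative parts against every `μ ∈ R`, such that the value function
`V(θ) = sup{μ(h) : μ ∈ R, μ(g_i) ≥ θ_i ∀i}` is real-valued on
`C = ∪_{μ∈R} {θ : μ(g_i) ≥ θ_i ∀i}`. If `θ̃` lies in the interior of `C` — equivalently,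
there is `μ̃ ∈ R` with `μ̃(g_i) > θ̃_i` for all `i` — then
`inf{sup{μ(h − ⟨λ,g⟩) : μ ∈ R} + ⟨λ,θ̃⟩ : λ ≤ 0} = sup{μ(h) : μ ∈ R, μ(g_i) ≥ θ̃_i ∀i}`. -/
theorem statement_17 {K : Type*} [MeasurableSpace K] (m : ℕ)
    (R : Set (Measure K)) (hRne : R.Nonempty)
    (hconv : ∀ μ₁ ∈ R, ∀ μ₂ ∈ R, ∀ β : ℝ, β ∈ Set.Icc (0 : ℝ) 1 →
      ENNReal.ofReal β • μ₁ + ENNReal.ofReal (1 - β) • μ₂ ∈ R)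
    (h : K → ℝ) (g : Fin m → K → ℝ)
    (hh : Measurable h) (hg : ∀ i, Measurable (g i))
    (hfinh : ∀ μ ∈ R, (∫⁻ x, ENNReal.ofReal (h x) ∂μ) < ⊤ ∧
      (∫⁻ x, ENNReal.ofReal (-h x) ∂μ) < ⊤)
    (hfing : ∀ μ ∈ R, ∀ i, (∫⁻ x, ENNReal.ofReal (g i x) ∂μ) < ⊤ ∧
      (∫⁻ x, ENNReal.ofReal (-g i x) ∂μ) < ⊤)
    -- `V` is real-valued on `C`
    (hreal : ∀ θ : Fin m → ℝ, (∃ μ ∈ R, ∀ i, θ i ≤ mVal μ (g i)) →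
      BddAbove {v : ℝ | ∃ μ ∈ R, (∀ i, θ i ≤ mVal μ (g i)) ∧ v = mVal μ h})
    (θt : Fin m → ℝ)
    -- `θ̃` is in the interior of `C`: Slater-type condition
    (hSlater : ∃ μt ∈ R, ∀ i, θt i < mVal μt (g i)) :
    sInf {w : EReal | ∃ lam : Fin m → ℝ, (∀ i, lam i ≤ 0) ∧
        w = sSup {v : EReal | ∃ μ ∈ R,
            v = (mVal μ (fun x => h x - ∑ i, lam i * g i x) : EReal)} +
          ((∑ i, lam i * θt i : ℝ) : EReal)} =
      sSup {v : EReal | ∃ μ ∈ R, (∀ i, θt i ≤ mVal μ (g i)) ∧ v = (mVal μ h : EReal)} := by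
  have hInth : ∀ μ ∈ R, Integrable h μ := fun μ hμ =>
    integrable_of_lintegral_ofReal_lt_top hh (hfinh μ hμ).1 (hfinh μ hμ).2
  have hIntg : ∀ μ ∈ R, ∀ i, Integrable (g i) μ := fun μ hμ i =>
    integrable_of_lintegral_ofReal_lt_top (hg i) (hfing μ hμ i).1 (hfing μ hμ i).2
  have hLag : ∀ μ ∈ R, ∀ lam : Fin m → ℝ, mVal μ (fun x => h x - ∑ i, lam i * g i x) =
      mVal μ h - ∑ i, lam i * mVal μ (g i) := fun μ hμ lam =>
    mVal_sub_sum (hInth μ hμ) (hIntg μ hμ) lam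
  apply le_antisymm
  · set A : Set (ℝ × (Fin m → ℝ)) := (fun μ => (mVal μ h, fun i => mVal μ (g i))) '' R
    have hAconv : Convex ℝ A := by
      rintro _ ⟨μ, hμ, rfl⟩ _ ⟨ν, hν, rfl⟩ a b ha hb hab
      have hmem := hconv μ hμ ν hν a ⟨ha, by linarith⟩
      rw [show 1 - a = b by linarith] at hmem
      refine ⟨_, hmem, ?_⟩
      ext i
      · simpa using mVal_convex_combination (hInth μ hμ) (hInth ν hν) ha hb
      · simpa using mVal_convex_combination (hIntg μ hμ i) (hIntg ν hν i) ha hb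
    obtain ⟨μt, hμt, hθ⟩ := hSlater
    set S : Set ℝ := {v : ℝ | ∃ μ ∈ R, (∀ i, θt i ≤ mVal μ (g i)) ∧ v = mVal μ h}
    have hSne : S.Nonempty := ⟨_, μt, hμt, fun i => (hθ i).le, rfl⟩
    have hSbdd : BddAbove S := hreal θt ⟨μt, hμt, fun i => (hθ i).le⟩
    obtain ⟨lam, hlam, hbound⟩ := exists_lagrange_multiplier (v := sSup S) hAconv
      ⟨_, ⟨μt, hμt, rfl⟩, hθ⟩ (by
        rintro _ ⟨μ, hμ, rfl⟩ hfeas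
        exact le_csSup hSbdd ⟨μ, hμ, hfeas, rfl⟩)
    have hvalue : ((sSup S : ℝ) : EReal) ≤
        sSup {v : EReal | ∃ μ ∈ R, (∀ i, θt i ≤ mVal μ (g i)) ∧ v = (mVal μ h : EReal)} := by
      refine le_of_forall_lt fun z hz => ?_
      obtain ⟨y, hzy, hy⟩ := EReal.lt_iff_exists_real_btwn.1 hz
      obtain ⟨_, ⟨μ, hμ, hfeas, rfl⟩, hlt⟩ := exists_lt_of_lt_csSup hSne (EReal.coe_lt_coe_iff.1 hy)
      exact hzy.trans ((EReal.coe_lt_coe_iff.2 hlt).trans_le (le_sSup ⟨μ, hμ, hfeas, rfl⟩))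
    refine sInf_le_of_le ⟨lam, hlam, rfl⟩ (le_trans ?_ hvalue)
    have hsup : sSup {v : EReal | ∃ μ ∈ R,
        v = (mVal μ (fun x => h x - ∑ i, lam i * g i x) : EReal)} ≤
        ((sSup S - ∑ i, lam i * θt i : ℝ) : EReal) := by
      refine sSup_le ?_
      rintro _ ⟨μ, hμ, rfl⟩
      have := hbound _ ⟨μ, hμ, rfl⟩
      rw [hLag μ hμ lam, EReal.coe_le_coe_iff]
      linarith
    refine (add_le_add_left hsup _).trans ?_
    rw [← EReal.coe_add, sub_add_cancel]
  · refine le_sInf ?_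
    rintro _ ⟨lam, hlam, rfl⟩
    refine sSup_le ?_
    rintro _ ⟨μ, hμ, hfeas, rfl⟩
    have hsup : (mVal μ (fun x => h x - ∑ i, lam i * g i x) : EReal) ≤ sSup {v : EReal | ∃ μ ∈ R,
        v = (mVal μ (fun x => h x - ∑ i, lam i * g i x) : EReal)} := le_sSup ⟨μ, hμ, rfl⟩
    refine le_trans ?_ (add_le_add_left hsup _)
    rw [← EReal.coe_add, EReal.coe_le_coe_iff, hLag μ hμ lam]
    have : ∑ i, lam i * mVal μ (g i) ≤ ∑ i, lam i * θt i :=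
      Finset.sum_le_sum fun i _ => mul_le_mul_of_nonpos_left (hfeas i) (hlam i)
    linarith
end
end
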